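/- Let n ≥ 1. The map φ from the set of subexceedant functions on {1, …, n} to the symmetric group S_n, defined by φ(f) = (n f(n))·(n−1 f(n−1))·⋯·(2 f(2))·(1 f(1)) (a product of transpositions, where (i f(i)) denotes the transposition exchanging i and f(i), taken to be the identity when f(i) = i), is a bijection. In particular, every permutation of {1, …, n} can be written uniquely in the form (n a_n)(n−1 a_{n-1})⋯(1 a_1) with 1 ≤ a_i ≤ i for each i. -/

import Mathlib

section SwapProducts

variable {α : Type*} [LinearOrder α]

/-- A product of transpositions `(i f(i))` with `f i ≤ i < a` fixes `a`. -/
theorem prod_map_swap_apply_of_forall_lt {f : α → α} (hf : ∀ i, f i ≤ i) {a : α} {l : List α}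
    (hl : ∀ i ∈ l, i < a) : (l.map fun i => Equiv.swap i (f i)).prod a = a := by
  induction l with
  | nil => simp
  | cons b l ih =>
    have hb : b < a := hl b (by simp)
    rw [List.map_cons, List.prod_cons, Equiv.Perm.mul_apply,
      ih fun i hi => hl i (List.mem_cons_of_mem _ hi)]
    exact Equiv.swap_apply_of_ne_of_ne hb.ne' ((hf b).trans_lt hb).ne'

/-- A product of transpositions `(i f(i))` with `f i ≤ i`, taken along a strictly decreasing list,
determines `f` on that list. -/
theorem eq_of_prod_map_swap_eq {f g : α → α} (hf : ∀ i, f i ≤ i) (hg : ∀ i, g i ≤ i)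
    {l : List α} (hl : l.Pairwise (· > ·))
    (h : (l.map fun i => Equiv.swap i (f i)).prod = (l.map fun i => Equiv.swap i (g i)).prod) :
    ∀ i ∈ l, f i = g i := by
  induction l with
  | nil => simp
  | cons a l ih =>
    obtain ⟨ha, hl⟩ := List.pairwise_cons.1 hl
    simp only [List.map_cons, List.prod_cons] at h
    have hfg : f a = g a := by
      have := congrArg (fun σ : Equiv.Perm α => σ a) h
      simpa [prod_map_swap_apply_of_forall_lt hf ha,
        prod_map_swap_apply_of_forall_lt hg ha] using this
    rw [hfg] at h
    rintro i (_ | ⟨_, hi⟩)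
    · exact hfg
    · exact ih hl (mul_left_cancel h) i hi

/-- A permutation that moves only entries of a strictly decreasing list is a product, along that
list, of transpositions `(i f(i))` with `f i ≤ i`. -/
theorem exists_prod_map_swap_eq {l : List α} (hl : l.Pairwise (· > ·)) (σ : Equiv.Perm α)
    (hσ : ∀ x, σ x ≠ x → x ∈ l) :
    ∃ f : α → α, (∀ i, f i ≤ i) ∧ (l.map fun i => Equiv.swap i (f i)).prod = σ := by
  induction l generalizing σ with
  | nil =>
    refine ⟨id, fun _ => le_rfl, ?_⟩
    ext x
    by_contra hx
    exact absurd (hσ x fun h => hx (by simp [h])) (by simp)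
  | cons a l ih =>
    obtain ⟨ha, hl⟩ := List.pairwise_cons.1 hl
    obtain ⟨f, hf, hprod⟩ := ih hl (Equiv.swap a (σ a) * σ) fun x hx => by
      have hxa : x ≠ a := by
        rintro rfl
        simp at hx
      by_contra hxl
      have hfix : σ x = x := by
        by_contra h
        exact (List.mem_cons.1 (hσ x h)).elim hxa hxl
      refine hx ?_
      rw [Equiv.Perm.mul_apply, hfix]
      exact Equiv.swap_apply_of_ne_of_ne hxa fun h => hxa (σ.injective (hfix.trans h))
    have hσa : σ a ≤ a := by
      by_cases h : σ a = a
      · exact h.le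
      · rcases List.mem_cons.1 (hσ (σ a) fun h' => h (σ.injective h')) with h' | h'
        · exact h'.le
        · exact (ha _ h').le
    refine ⟨Function.update f a (σ a), fun i => ?_, ?_⟩
    · rcases eq_or_ne i a with rfl | hi
      · simpa using hσa
      · simpa [hi] using hf i
    · have hcongr : (l.map fun i => Equiv.swap i (Function.update f a (σ a) i)) =
          l.map fun i => Equiv.swap i (f i) :=
        List.map_congr_left fun i hi => by rw [Function.update_of_ne (ha i hi).ne]
      rw [List.map_cons, List.prod_cons, hcongr, hprod, Function.update_self, ← mul_assoc,
        Equiv.swap_mul_self, one_mul]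

end SwapProducts

/-- The map `φ` from subexceedant functions on `{1,…,n}` (modelled 0-based as
functions `f : Fin n → Fin n` with `f i ≤ i`) to the symmetric group `Sₙ`, sending
`f` to the product of transpositions `(n f(n))·(n-1 f(n-1))⋯(1 f(1))` (rightmost
factor acting first; a factor is the identity when `f i = i`), is a bijection.
In particular every permutation of `{1,…,n}` is uniquely of this form. -/
theorem subexceedant_to_perm_bijective (n : ℕ) (hn : 1 ≤ n) :
    Function.Bijective
      (fun f : {f : Fin n → Fin n // ∀ i, f i ≤ i} =>
        (((List.finRange n).reverse.map fun i => Equiv.swap i (f.1 i)).prod :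
          Equiv.Perm (Fin n))) := by
  have hl : (List.finRange n).reverse.Pairwise (· > ·) :=
    List.pairwise_reverse.2 (List.pairwise_lt_finRange n)
  refine ⟨fun f g h => ?_, fun σ => ?_⟩
  · exact Subtype.ext (funext fun i => eq_of_prod_map_swap_eq f.2 g.2 hl h i (by simp))
  · obtain ⟨f, hf, hprod⟩ := exists_prod_map_swap_eq hl σ (by simp)
    exact ⟨⟨f, hf⟩, hprod⟩
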